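/- Every clopen subset p of the binary Cantor space C such that μ(p) = k / 2^(2m+1) for some m, k ∈ ℕ with 0 < k ≤ 2^(2m+1) and 3 dividing k − 2, belongs to Ω₂, i.e. there exists f in Thompson's group F with p_f = p. (Converse direction of the characterization of Ω₂; combined with the forward direction, Ω₂ consists exactly of such clopen sets.) -/

import Mathlib

open Set MeasureTheory Filter Topology

/-- The binary Cantor space. -/
abbrev CantorC : Type := ℕ → Bool

/-- Finite binary words. -/
abbrev BWord : Type := List Bool

/-- Prepend a finite word to an infinite binary sequence. -/
def wordApp (w : BWord) (x : CantorC) : CantorC := fun n =>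
  if h : n < w.length then w.get ⟨n, h⟩ else x (n - w.length)

/-- The cylinder of sequences beginning with the word `w`. -/
def cyl (w : BWord) : Set CantorC := Set.range (wordApp w)

/-- `J` is a code: both the α-cylinders and the β-cylinders form a partition of the
Cantor space (every point lies in the cylinder of exactly one pair). -/
def IsCode (J : Finset (BWord × BWord)) : Prop :=
  (∀ x : CantorC, ∃! p : BWord × BWord, p ∈ J ∧ x ∈ cyl p.1) ∧
  (∀ x : CantorC, ∃! p : BWord × BWord, p ∈ J ∧ x ∈ cyl p.2)

/-- `J` is order preserving: α ≺ α' lexicographically iff β ≺ β' lexicographically. -/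
def OrdPres (J : Finset (BWord × BWord)) : Prop :=
  ∀ p ∈ J, ∀ q ∈ J, (List.Lex (· < ·) p.1 q.1 ↔ List.Lex (· < ·) p.2 q.2)

/-- The bijection `g` is induced by the code `J` : it maps `β·x` to `α·x`. -/
def InducedBy (J : Finset (BWord × BWord)) (g : Equiv.Perm CantorC) : Prop :=
  ∀ p ∈ J, ∀ x : CantorC, g (wordApp p.2 x) = wordApp p.1 x

/-- `J` is an order-preserving code inducing the bijection `g`. -/
def IsCodeFor (J : Finset (BWord × BWord)) (g : Equiv.Perm CantorC) : Prop :=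
  IsCode J ∧ OrdPres J ∧ InducedBy J g

/-- Membership in (the realization on the Cantor space of) Thompson's group `F`. -/
def InF (g : Equiv.Perm CantorC) : Prop := ∃ J, IsCodeFor J g

/-- The pair `(α, β)` has `|α| ≡ |β| (mod 2)`. -/
def EvenPair (p : BWord × BWord) : Prop := p.1.length % 2 = p.2.length % 2

/-- Membership in the subgroup `H₂` : some order-preserving code for `g` has all
pairs of even length difference. -/
def InH2 (g : Equiv.Perm CantorC) : Prop :=
  ∃ J, IsCodeFor J g ∧ ∀ p ∈ J, EvenPair p

/-- The union of the α-cylinders over pairs of even length difference. -/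
def pSet (J : Finset (BWord × BWord)) : Set CantorC :=
  {x | ∃ p ∈ J, EvenPair p ∧ x ∈ cyl p.1}

/-- The union of the β-cylinders over pairs of even length difference. -/
def eSet (J : Finset (BWord × BWord)) : Set CantorC :=
  {x | ∃ p ∈ J, EvenPair p ∧ x ∈ cyl p.2}

/-- `p_f` : for `f ∈ F` this equals `pSet J` for any (equivalently, every)
order-preserving code `J` for `f`. -/
def pF (g : Equiv.Perm CantorC) : Set CantorC :=
  ⋃ J ∈ {J : Finset (BWord × BWord) | IsCodeFor J g}, pSet J

/-- `E_f` : for `f ∈ F` this equals `eSet J` for any (equivalently, every)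
order-preserving code `J` for `f`. -/
def EF (g : Equiv.Perm CantorC) : Set CantorC :=
  ⋃ J ∈ {J : Finset (BWord × BWord) | IsCodeFor J g}, eSet J

/-- `Ω₂ = {p_f : f ∈ F}`. -/
def Omega2 : Set (Set CantorC) := {p | ∃ g, InF g ∧ pF g = p}

/-- The action `f · p = f(p ∩ E_f) ∪ f((C ∖ p) ∩ (C ∖ E_f))`. -/
def actF (g : Equiv.Perm CantorC) (p : Set CantorC) : Set CantorC :=
  g '' (p ∩ EF g) ∪ g '' (pᶜ ∩ (EF g)ᶜ)

open Classical in
/-- `T(p)` as a Boolean-valued characteristic function: `T(p) w = true` iff the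
cylinder of `w` meets `p`. -/
noncomputable def Tb (p : Set CantorC) : BWord → Bool :=
  fun w => if (cyl w ∩ p).Nonempty then true else false

/-- The embedding `p ↦ (T(p), T(C ∖ p))`. -/
noncomputable def embedT (p : Set CantorC) : (BWord → Bool) × (BWord → Bool) :=
  (Tb p, Tb pᶜ)

/-- `Ω̄₂` : the closure of the image of `Ω₂` under the embedding. -/
noncomputable def OmegaBar : Set ((BWord → Bool) × (BWord → Bool)) :=
  closure (embedT '' Omega2)

/-! ### Words of depth parities -/

/-- Replace one letter of a word of depth parities by the two letters of its children. -/
inductive ParityStep : List Bool → List Bool → Prop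
  | split (u : List Bool) (x : Bool) (v : List Bool) :
      ParityStep (u ++ x :: v) (u ++ (!x) :: (!x) :: v)

/-- The word `w` and the one-letter word of the root have a common expansion. -/
def ParityGood (w : List Bool) : Prop :=
  Relation.Join (Relation.ReflTransGen ParityStep) w [true]

theorem ParityStep.diamond {a b c : List Bool} (hb : ParityStep a b) (hc : ParityStep a c) :
    ∃ d, Relation.ReflGen ParityStep b d ∧ Relation.ReflTransGen ParityStep c d := by
  obtain ⟨u, x, v⟩ := hb
  generalize ha : u ++ x :: v = a at hc
  obtain ⟨u', x', v'⟩ := hc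
  have key : ∀ (u : List Bool) (x : Bool) (t : List Bool) (y : Bool) (v : List Bool),
      ParityStep (u ++ (!x) :: (!x) :: (t ++ y :: v))
        (u ++ (!x) :: (!x) :: (t ++ (!y) :: (!y) :: v)) ∧
      ParityStep (u ++ x :: (t ++ (!y) :: (!y) :: v))
        (u ++ (!x) :: (!x) :: (t ++ (!y) :: (!y) :: v)) := by
    intro u x t y v
    refine ⟨?_, .split u x _⟩
    simpa using ParityStep.split (u ++ (!x) :: (!x) :: t) y v
  rcases List.append_eq_append_iff.1 ha with ⟨t, ht, ht'⟩ | ⟨t, ht, ht'⟩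
  · cases t with
    | nil =>
      simp only [List.nil_append, List.cons.injEq] at ht'
      obtain ⟨rfl, rfl⟩ := ht'
      simp only [List.append_nil] at ht
      subst ht
      exact ⟨_, .refl, .refl⟩
    | cons z t =>
      simp only [List.cons_append, List.cons.injEq] at ht'
      obtain ⟨rfl, rfl⟩ := ht'
      subst ht
      obtain ⟨h1, h2⟩ := key u x t x' v'
      exact ⟨_, .single h1, .single (by simpa using h2)⟩
  · cases t with
    | nil =>
      simp only [List.nil_append, List.cons.injEq] at ht'
      obtain ⟨rfl, rfl⟩ := ht'
      simp only [List.append_nil] at ht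
      subst ht
      exact ⟨_, .refl, .refl⟩
    | cons z t =>
      simp only [List.cons_append, List.cons.injEq] at ht'
      obtain ⟨rfl, rfl⟩ := ht'
      subst ht
      obtain ⟨h1, h2⟩ := key u' x' t x v
      exact ⟨_, .single (by simpa using h2), .single h1⟩

theorem ParityGood.of_step {w w' : List Bool} (h : ParityStep w w') (hw : ParityGood w') :
    ParityGood w := by
  obtain ⟨z, h1, h2⟩ := hw
  exact ⟨z, h1.head h, h2⟩

theorem ParityGood.step {w w' : List Bool} (h : ParityStep w' w) (hw : ParityGood w') :
    ParityGood w := by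
  obtain ⟨z, h1, h2⟩ := hw
  obtain ⟨d, hd, hd'⟩ := Relation.church_rosser (fun _ _ _ => ParityStep.diamond) h1
    (Relation.ReflTransGen.single h)
  exact ⟨d, hd', h2.trans hd⟩

/-- The weight of a parity: `1` for even depth and `-1` for odd depth, modulo `3`. -/
def parityWeight (b : Bool) : ZMod 3 := if b then 1 else -1

theorem parityGood_of_sum (w : List Bool) (hw : (w.map parityWeight).sum = 1) :
    ParityGood w := by
  have two : ∀ x, parityWeight x + parityWeight x = parityWeight !x := by decide
  have cancel : ∀ x, parityWeight x + parityWeight (!x) = 0 := by decide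
  induction hn : w.length using Nat.strong_induction_on generalizing w with
  | _ n ih =>
  subst hn
  match w with
  | [] => exact absurd hw (by decide)
  | [x] =>
    cases x
    · exact absurd hw (by decide)
    · exact ⟨_, .refl, .refl⟩
  | x :: y :: v =>
    by_cases hxy : y = x
    · subst hxy
      have h : ParityGood ((!y) :: v) := ih _ (by simp) _
        (by simpa [← two, add_assoc] using hw) rfl
      simpa using h.step (by simpa using ParityStep.split [] (!y) v)
    · obtain rfl : y = !x := by cases x <;> cases y <;> simp_all
      match v with
      | [] =>
        have := cancel x
        simp [this] at hw
      | z :: v =>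
        by_cases hzx : z = x
        · subst hzx
          have h : ParityGood (z :: v) := ih _ (by simp) _
            (by simpa [← add_assoc, cancel] using hw) rfl
          have h1 : ParityGood ((!z) :: (!z) :: v) := h.step (ParityStep.split [] z v)
          have h2 : ParityGood ((!z) :: z :: z :: v) :=
            h1.step (by simpa using ParityStep.split [!z] (!z) v)
          have h3 : ParityGood ((!z) :: (!z) :: (!z) :: z :: v) :=
            h2.step (ParityStep.split [!z] z (z :: v))
          exact h3.of_step (ParityStep.split [] z ((!z) :: z :: v))
        · obtain rfl : z = !x := by cases x <;> cases z <;> simp_all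
          have h : ParityGood (x :: x :: v) := ih _ (by simp) _ (by
            have h2 := two (!x)
            simp only [Bool.not_not] at h2
            simpa [← h2, add_assoc] using hw) rfl
          exact h.step (ParityStep.split [x] x v)

/-! ### Words and cylinders -/

theorem wordApp_nil (x : CantorC) : wordApp [] x = x := by
  funext n; simp [wordApp]

theorem wordApp_append (a b : BWord) (x : CantorC) :
    wordApp (a ++ b) x = wordApp a (wordApp b x) := by
  funext n
  simp only [wordApp, List.length_append, List.get_eq_getElem]
  by_cases h : n < a.length
  · simp [h, List.getElem_append_left, Nat.lt_add_right]
  · by_cases h' : n < a.length + b.length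
    · have h1 : n - a.length < b.length := by omega
      simp [h, h', h1, List.getElem_append_right (not_lt.1 h)]
    · have h1 : ¬ n - a.length < b.length := by omega
      simp [h, h', h1, Nat.sub_sub]

theorem wordApp_length_add (w : BWord) (x : CantorC) (n : ℕ) :
    wordApp w x (w.length + n) = x n := by
  simp [wordApp]

theorem wordApp_injective (w : BWord) : Function.Injective (wordApp w) := by
  intro x y h
  funext n
  simpa only [wordApp_length_add] using congrFun h (w.length + n)

theorem wordApp_of_lt (w : BWord) (x : CantorC) {n : ℕ} (h : n < w.length) :
    wordApp w x n = w[n] := by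
  simp [wordApp, h]

theorem length_eq_of_wordApp_eq {a b : BWord} (h : ∀ z, wordApp a z = wordApp b z) :
    a.length = b.length := by
  have key : ∀ a b : BWord, (∀ z, wordApp a z = wordApp b z) → b.length ≤ a.length := by
    intro a b h
    by_contra! hlt
    have h1 := congrFun (h fun n => decide (n = 0)) (b.length + 0)
    rw [wordApp_length_add] at h1
    obtain ⟨d, hd⟩ := Nat.exists_eq_add_of_lt hlt
    rw [hd, add_zero, add_assoc, wordApp_length_add] at h1
    simp at h1
  exact le_antisymm (key b a fun z => (h z).symm) (key a b h)

theorem mem_cyl_iff {w : BWord} {x : CantorC} :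
    x ∈ cyl w ↔ ∀ (i : ℕ) (h : i < w.length), x i = w[i] := by
  constructor
  · rintro ⟨y, rfl⟩ i h
    exact wordApp_of_lt w y h
  · intro h
    refine ⟨fun n => x (w.length + n), funext fun n => ?_⟩
    by_cases hn : n < w.length
    · rw [wordApp_of_lt _ _ hn, h n hn]
    · obtain ⟨d, rfl⟩ := Nat.exists_eq_add_of_le (not_lt.1 hn)
      rw [wordApp_length_add]

theorem measurableSet_cyl (w : BWord) : MeasurableSet (cyl w) := by
  have : cyl w = ⋂ (i : ℕ) (h : i < w.length), (fun x : CantorC => x i) ⁻¹' {w[i]} := by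
    ext x
    simp [mem_cyl_iff]
  rw [this]
  exact .iInter fun i => .iInter fun _ => measurable_pi_apply i (measurableSet_singleton _)

theorem cyl_append_subset (a b : BWord) : cyl (a ++ b) ⊆ cyl a := by
  rintro _ ⟨x, rfl⟩
  exact ⟨wordApp b x, (wordApp_append a b x).symm⟩

theorem exists_append_of_mem_cyl {a b : BWord} {x : CantorC} (ha : x ∈ cyl a) (hb : x ∈ cyl b)
    (hab : a.length ≤ b.length) : ∃ c, b = a ++ c := by
  rw [mem_cyl_iff] at ha hb
  have : a <+: b := by
    rw [List.prefix_iff_getElem]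
    exact ⟨hab, fun i hi => by rw [← ha i hi, hb i (by omega)]⟩
  obtain ⟨c, hc⟩ := this
  exact ⟨c, hc.symm⟩

theorem exists_mem_cyl_append_singleton {w : BWord} {x : CantorC} (hx : x ∈ cyl w) :
    ∃ b, x ∈ cyl (w ++ [b]) := by
  obtain ⟨y, rfl⟩ := hx
  refine ⟨y 0, fun n => y (n + 1), ?_⟩
  rw [wordApp_append]
  congr 1
  funext n
  cases n <;> simp [wordApp]

/-- `a` is strictly to the left of `b`, neither being a prefix of the other. -/
def LeftOf (a b : BWord) : Prop :=
  ∃ c a' b', a = c ++ false :: a' ∧ b = c ++ true :: b'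

theorem LeftOf.append {a b : BWord} (h : LeftOf a b) (u v : BWord) :
    LeftOf (a ++ u) (b ++ v) := by
  obtain ⟨c, a', b', rfl, rfl⟩ := h
  exact ⟨c, a' ++ u, b' ++ v, by simp, by simp⟩

theorem LeftOf.cons {a b : BWord} (h : LeftOf a b) (x : Bool) : LeftOf (x :: a) (x :: b) := by
  obtain ⟨c, a', b', rfl, rfl⟩ := h
  exact ⟨x :: c, a', b', rfl, rfl⟩

theorem LeftOf.notMem_cyl {a b : BWord} (h : LeftOf a b) {x : CantorC} (ha : x ∈ cyl a) :
    x ∉ cyl b := by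
  obtain ⟨c, a', b', rfl, rfl⟩ := h
  intro hb
  rw [mem_cyl_iff] at ha hb
  have h1 := ha c.length (by simp)
  have h2 := hb c.length (by simp)
  simp [h1] at h2

theorem LeftOf.lex {a b : BWord} (h : LeftOf a b) : List.Lex (· < ·) a b := by
  obtain ⟨c, a', b', rfl, rfl⟩ := h
  induction c with
  | nil => exact .rel (by decide)
  | cons x c ih => exact .cons ih

/-! ### Complete prefix codes in increasing order -/

/-- The words of `A`, listed from left to right, form a complete prefix code. -/
def IsLeafList (A : List BWord) : Prop :=
  A.Pairwise LeftOf ∧ ∀ x : CantorC, ∃ a ∈ A, x ∈ cyl a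

theorem IsLeafList.split {A B : List BWord} {w : BWord} (h : IsLeafList (A ++ w :: B)) :
    IsLeafList (A ++ (w ++ [false]) :: (w ++ [true]) :: B) := by
  obtain ⟨h, hc⟩ := h
  constructor
  · simp only [List.pairwise_append, List.pairwise_cons, List.mem_cons] at h ⊢
    obtain ⟨hA, ⟨hw, hB⟩, hAB⟩ := h
    have hl : ∀ a ∈ A, ∀ t, LeftOf a (w ++ t) := fun a ha t => by
      simpa using (hAB a ha w (.inl rfl)).append [] t
    have hr : ∀ b ∈ B, ∀ t, LeftOf (w ++ t) b := fun b hb t => by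
      simpa using (hw b hb).append t []
    refine ⟨hA, ⟨?_, fun b hb => hr b hb _, hB⟩, ?_⟩
    · rintro b (rfl | hb)
      · exact ⟨w, [], [], rfl, rfl⟩
      · exact hr b hb _
    · rintro a ha b (rfl | rfl | hb)
      · exact hl a ha _
      · exact hl a ha _
      · exact hAB a ha b (.inr hb)
  · intro x
    obtain ⟨a, ha, hx⟩ := hc x
    rw [List.mem_append, List.mem_cons] at ha
    rcases ha with ha | rfl | ha
    · exact ⟨a, by simp [ha], hx⟩
    · obtain ⟨b, hb⟩ := exists_mem_cyl_append_singleton hx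
      exact ⟨a ++ [b], by cases b <;> simp, hb⟩
    · exact ⟨a, by simp [ha], hx⟩

/-- The first components form a complete prefix code, each of whose cylinders lies in `p` or in its
complement; the second component is the parity of the length (`true` for even), flipped off `p`. -/
def IsParityMarking (p : Set CantorC) (L : List (BWord × Bool)) : Prop :=
  IsLeafList (L.map Prod.fst) ∧
    ∀ q ∈ L, ∀ x ∈ cyl q.1, (x ∈ p ↔ (q.2 = true ↔ Even q.1.length))

theorem IsParityMarking.exists_of_step {p : Set CantorC} {L : List (BWord × Bool)}
    (hL : IsParityMarking p L) {z : List Bool} (hz : ParityStep (L.map Prod.snd) z) :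
    ∃ L', IsParityMarking p L' ∧ L'.map Prod.snd = z := by
  generalize hw : L.map Prod.snd = w at hz
  obtain ⟨u, x, v⟩ := hz
  obtain ⟨U, R, rfl, rfl, hR⟩ := List.map_eq_append_iff.1 hw
  obtain ⟨⟨a, y⟩, V, rfl, rfl, rfl⟩ := List.map_eq_cons_iff.1 hR
  refine ⟨U ++ (a ++ [false], !y) :: (a ++ [true], !y) :: V, ⟨?_, ?_⟩, by simp⟩
  · simpa using IsLeafList.split (by simpa using hL.1)
  · have hchild : ∀ b, ∀ x ∈ cyl (a ++ [b]),
        (x ∈ p ↔ ((!y) = true ↔ Even (a ++ [b]).length)) := by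
      intro b x hx
      rw [hL.2 (a, y) (by simp) x (cyl_append_subset a [b] hx)]
      cases y <;> simp [Nat.even_add_one]
    intro q hq
    simp only [List.mem_append, List.mem_cons] at hq
    rcases hq with hq | rfl | rfl | hq
    · exact hL.2 q (by simp [hq])
    · exact hchild false
    · exact hchild true
    · exact hL.2 q (by simp [hq])

theorem IsParityMarking.exists_of_steps {p : Set CantorC} {L : List (BWord × Bool)}
    (hL : IsParityMarking p L) {z : List Bool}
    (hz : Relation.ReflTransGen ParityStep (L.map Prod.snd) z) :
    ∃ L', IsParityMarking p L' ∧ L'.map Prod.snd = z := by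
  induction hz with
  | refl => exact ⟨L, hL, rfl⟩
  | tail _ h ih =>
    obtain ⟨L', hL', rfl⟩ := ih
    exact hL'.exists_of_step h

theorem isParityMarking_root : IsParityMarking univ [([], true)] := by
  refine ⟨⟨by simp, fun x => ⟨[], by simp, x, wordApp_nil x⟩⟩, ?_⟩
  simp

/-! ### Codes and the bijections they induce -/

theorem IsCode.swap {J : Finset (BWord × BWord)} (hJ : IsCode J) :
    IsCode (J.map (Equiv.prodComm _ _).toEmbedding) := by
  constructor
  · intro x
    obtain ⟨q, hq, hu⟩ := hJ.2 x
    refine ⟨q.swap, by simpa using hq, fun r hr => ?_⟩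
    rw [← hu r.swap (by simpa using hr), Prod.swap_swap]
  · intro x
    obtain ⟨q, hq, hu⟩ := hJ.1 x
    refine ⟨q.swap, by simpa using hq, fun r hr => ?_⟩
    rw [← hu r.swap (by simpa using hr), Prod.swap_swap]

theorem IsCode.exists_map {J : Finset (BWord × BWord)} (hJ : IsCode J) :
    ∃ f : CantorC → CantorC, ∀ q ∈ J, ∀ x, f (wordApp q.2 x) = wordApp q.1 x := by
  choose s hs hu using hJ.2
  choose y hy using fun x => (hs x).2
  refine ⟨fun x => wordApp (s x).1 (y x), fun q hq x => ?_⟩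
  have h : q = s (wordApp q.2 x) := hu _ q ⟨hq, x, rfl⟩
  have h1 : y (wordApp q.2 x) = x := by
    apply wordApp_injective q.2
    have := hy (wordApp q.2 x)
    rwa [← h] at this
  simp only [h1, ← h]

theorem IsCode.exists_inducedBy {J : Finset (BWord × BWord)} (hJ : IsCode J) :
    ∃ g, InducedBy J g := by
  obtain ⟨f, hf⟩ := hJ.exists_map
  obtain ⟨f', hf'⟩ := hJ.swap.exists_map
  have hf' : ∀ q ∈ J, ∀ x, f' (wordApp q.1 x) = wordApp q.2 x := fun q hq x =>
    hf' q.swap (by simpa using hq) x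
  refine ⟨⟨f, f', fun x => ?_, fun x => ?_⟩, hf⟩
  · obtain ⟨q, ⟨hq, y, rfl⟩, -⟩ := hJ.2 x
    rw [hf q hq, hf' q hq]
  · obtain ⟨q, ⟨hq, y, rfl⟩, -⟩ := hJ.1 x
    rw [hf' q hq, hf q hq]

theorem InducedBy.length_add_length {J J' : Finset (BWord × BWord)} {g : Equiv.Perm CantorC}
    (hJ : InducedBy J g) (hJ' : InducedBy J' g) {q q' : BWord × BWord} (hq : q ∈ J)
    (hq' : q' ∈ J') {x : CantorC} (hx : x ∈ cyl q.1) (hx' : x ∈ cyl q'.1) :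
    q.1.length + q'.2.length = q'.1.length + q.2.length := by
  wlog hle : q.1.length ≤ q'.1.length generalizing q q' J J'
  · exact (this hJ' hJ hq' hq hx' hx (by omega)).symm
  obtain ⟨c, hc⟩ := exists_append_of_mem_cyl hx hx' hle
  have h : ∀ z, wordApp (q.2 ++ c) z = wordApp q'.2 z := by
    intro z
    apply g.injective
    rw [wordApp_append, hJ q hq, hJ' q' hq', hc, wordApp_append]
  have h1 := length_eq_of_wordApp_eq h
  have h2 := congrArg List.length hc
  simp only [List.length_append] at h1 h2
  omega

theorem IsCodeFor.pSet_subset {J J' : Finset (BWord × BWord)} {g : Equiv.Perm CantorC}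
    (hJ : IsCodeFor J g) (hJ' : IsCodeFor J' g) : pSet J ⊆ pSet J' := by
  rintro x ⟨q, hq, he, hx⟩
  obtain ⟨q', ⟨hq', hx'⟩, -⟩ := hJ'.1.1 x
  refine ⟨q', hq', ?_, hx'⟩
  have := hJ.2.2.length_add_length hJ'.2.2 hq hq' hx hx'
  unfold EvenPair at *
  omega

theorem IsCodeFor.pF_eq {J : Finset (BWord × BWord)} {g : Equiv.Perm CantorC}
    (hJ : IsCodeFor J g) : pF g = pSet J :=
  Subset.antisymm (iUnion₂_subset fun _ hJ' => IsCodeFor.pSet_subset hJ' hJ)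
    (subset_iUnion₂_of_subset J hJ Subset.rfl)

theorem IsCodeFor.pSet_mem_Omega2 {J : Finset (BWord × BWord)} {g : Equiv.Perm CantorC}
    (hJ : IsCodeFor J g) : pSet J ∈ Omega2 :=
  ⟨g, ⟨J, hJ⟩, hJ.pF_eq⟩

theorem existsUnique_mem_cyl {n : ℕ} {a : Fin n → BWord} (ha : ∀ i j, i < j → LeftOf (a i) (a j))
    (hc : ∀ x, ∃ i, x ∈ cyl (a i)) (x : CantorC) : ∃! i, x ∈ cyl (a i) := by
  obtain ⟨i, hi⟩ := hc x
  refine ⟨i, hi, fun j hj => ?_⟩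
  rcases lt_trichotomy i j with h | h | h
  · exact absurd hj ((ha i j h).notMem_cyl hi)
  · exact h.symm
  · exact absurd hi ((ha j i h).notMem_cyl hj)

theorem lex_iff_lt {n : ℕ} {a : Fin n → BWord} (ha : ∀ i j, i < j → LeftOf (a i) (a j))
    (i j : Fin n) : List.Lex (· < ·) (a i) (a j) ↔ i < j := by
  refine ⟨fun h => ?_, fun h => (ha i j h).lex⟩
  by_contra! hji
  rcases hji.eq_or_lt with rfl | hji
  · exact lt_irrefl (a j) h
  · exact lt_asymm (show a i < a j from h) (ha j i hji).lex

theorem isCode_image {n : ℕ} {a b : Fin n → BWord} (ha : ∀ x, ∃! i, x ∈ cyl (a i))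
    (hb : ∀ x, ∃! i, x ∈ cyl (b i)) :
    IsCode (Finset.univ.image fun i => (a i, b i)) := by
  constructor
  · intro x
    obtain ⟨i, hi, hu⟩ := ha x
    refine ⟨(a i, b i), ⟨Finset.mem_image_of_mem _ (Finset.mem_univ i), hi⟩, ?_⟩
    rintro q ⟨hq, hx⟩
    obtain ⟨j, -, rfl⟩ := Finset.mem_image.1 hq
    rw [hu j hx]
  · intro x
    obtain ⟨i, hi, hu⟩ := hb x
    refine ⟨(a i, b i), ⟨Finset.mem_image_of_mem _ (Finset.mem_univ i), hi⟩, ?_⟩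
    rintro q ⟨hq, hx⟩
    obtain ⟨j, -, rfl⟩ := Finset.mem_image.1 hq
    rw [hu j hx]

theorem IsLeafList.leftOf_getElem {A : List BWord} (hA : IsLeafList A) {i j : ℕ} (hij : i < j)
    (hj : j < A.length) : LeftOf (A[i]'(hij.trans hj)) A[j] :=
  List.pairwise_iff_getElem.1 hA.1 i j (hij.trans hj) hj hij

theorem mem_Omega2_of_isParityMarking {p : Set CantorC} {L M : List (BWord × Bool)}
    (hL : IsParityMarking p L) (hM : IsParityMarking univ M)
    (hLM : L.map Prod.snd = M.map Prod.snd) : p ∈ Omega2 := by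
  have hlen : L.length = M.length := by simpa using congrArg List.length hLM
  let a : Fin L.length → BWord := fun i => L[i].1
  let b : Fin L.length → BWord := fun i => (M[(i : ℕ)]'(by omega)).1
  have ha : ∀ i j, i < j → LeftOf (a i) (a j) := fun i j hij => by
    simpa [a] using hL.1.leftOf_getElem (i := i) (j := j) hij (by simp)
  have hb : ∀ i j, i < j → LeftOf (b i) (b j) := fun i j hij => by
    have hj : (j : ℕ) < (M.map Prod.fst).length := by simp [← hlen]
    simpa only [List.getElem_map] using hM.1.leftOf_getElem (i := i) (j := j) hij hj
  have hac : ∀ x, ∃ i, x ∈ cyl (a i) := fun x => by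
    obtain ⟨w, hw, hx⟩ := hL.1.2 x
    obtain ⟨q, hq, rfl⟩ := List.mem_map.1 hw
    obtain ⟨i, hi, rfl⟩ := List.mem_iff_getElem.1 hq
    exact ⟨⟨i, hi⟩, hx⟩
  have hbc : ∀ x, ∃ i, x ∈ cyl (b i) := fun x => by
    obtain ⟨w, hw, hx⟩ := hM.1.2 x
    obtain ⟨q, hq, rfl⟩ := List.mem_map.1 hw
    obtain ⟨i, hi, rfl⟩ := List.mem_iff_getElem.1 hq
    exact ⟨⟨i, by omega⟩, hx⟩
  have heven : ∀ i, ∀ x ∈ cyl (a i), (x ∈ p ↔ EvenPair (a i, b i)) := by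
    intro i x hx
    have h1 := hL.2 L[i] (by simp) x hx
    have h2 := hM.2 (M[(i : ℕ)]'(by omega)) (by simp) _ ⟨x, rfl⟩
    have h3 : L[i].2 = (M[(i : ℕ)]'(by omega)).2 := by
      have := List.getElem_of_eq hLM (i := i) (by simp)
      simpa using this
    simp only [mem_univ, true_iff] at h2
    rw [h1, h3, h2]
    simp only [EvenPair, a, b, Nat.even_iff]
    omega
  have hcode := isCode_image (existsUnique_mem_cyl ha hac) (existsUnique_mem_cyl hb hbc)
  obtain ⟨g, hg⟩ := hcode.exists_inducedBy
  have hord : OrdPres (Finset.univ.image fun i => (a i, b i)) := by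
    intro q hq r hr
    obtain ⟨i, -, rfl⟩ := Finset.mem_image.1 hq
    obtain ⟨j, -, rfl⟩ := Finset.mem_image.1 hr
    rw [lex_iff_lt ha, lex_iff_lt hb]
  convert IsCodeFor.pSet_mem_Omega2 ⟨hcode, hord, hg⟩
  ext x
  constructor
  · intro hx
    obtain ⟨i, hi⟩ := hac x
    exact ⟨_, Finset.mem_image_of_mem _ (Finset.mem_univ i), (heven i x hi).1 hx, hi⟩
  · rintro ⟨q, hq, he, hx⟩
    obtain ⟨i, -, rfl⟩ := Finset.mem_image.1 hq
    exact (heven i x hx).2 he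

/-! ### Clopen sets at a fixed level -/

/-- The words of length `n`, from left to right. -/
def levelWords : ℕ → List BWord
  | 0 => [[]]
  | n + 1 => (levelWords n).map (false :: ·) ++ (levelWords n).map (true :: ·)

theorem length_levelWords (n : ℕ) : (levelWords n).length = 2 ^ n := by
  induction n with
  | zero => rfl
  | succ n ih => simp [levelWords, ih, pow_succ, mul_two]

theorem length_of_mem_levelWords {n : ℕ} {w : BWord} (hw : w ∈ levelWords n) : w.length = n := by
  induction n generalizing w with
  | zero => simp_all [levelWords]
  | succ n ih =>
    simp only [levelWords, List.mem_append, List.mem_map] at hw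
    rcases hw with ⟨v, hv, rfl⟩ | ⟨v, hv, rfl⟩ <;> simp [ih hv]

theorem mem_levelWords_length (w : BWord) : w ∈ levelWords w.length := by
  induction w with
  | nil => simp [levelWords]
  | cons b w ih => cases b <;> simp [levelWords, ih]

theorem isLeafList_levelWords (n : ℕ) : IsLeafList (levelWords n) := by
  constructor
  · induction n with
    | zero => simp [levelWords]
    | succ n ih =>
      simp only [levelWords, List.pairwise_append, List.pairwise_map]
      refine ⟨ih.imp fun h => h.cons _, ih.imp fun h => h.cons _, ?_⟩
      simp only [List.mem_map]
      rintro _ ⟨v, -, rfl⟩ _ ⟨w, -, rfl⟩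
      exact ⟨[], v, w, rfl, rfl⟩
  · intro x
    refine ⟨List.ofFn fun i : Fin n => x i, ?_, ?_⟩
    · simpa using mem_levelWords_length (List.ofFn fun i : Fin n => x i)
    · simp [mem_cyl_iff]

theorem exists_nat_forall_eq_imp_mem {s : Set CantorC} (hs : IsOpen s) {x : CantorC}
    (hx : x ∈ s) : ∃ n : ℕ, ∀ y : CantorC, (∀ i < n, y i = x i) → y ∈ s := by
  obtain ⟨I, u, hu, hus⟩ := isOpen_pi_iff.1 hs x hx
  refine ⟨I.sup id + 1, fun y hy => hus fun i hi => ?_⟩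
  rw [hy i (Nat.lt_succ_of_le (Finset.le_sup (f := id) hi))]
  exact (hu i hi).2

theorem IsClopen.exists_nat_forall_eq_imp_mem_iff {p : Set CantorC} (hp : IsClopen p) :
    ∃ n : ℕ, ∀ x y : CantorC, (∀ i < n, x i = y i) → (x ∈ p ↔ y ∈ p) := by
  have hloc : ∀ x : CantorC, ∃ n : ℕ, ∀ y : CantorC, (∀ i < n, y i = x i) → (y ∈ p ↔ x ∈ p) := by
    intro x
    by_cases hx : x ∈ p
    · obtain ⟨n, hn⟩ := exists_nat_forall_eq_imp_mem hp.isOpen hx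
      exact ⟨n, fun y hy => iff_of_true (hn y hy) hx⟩
    · obtain ⟨n, hn⟩ := exists_nat_forall_eq_imp_mem hp.compl.isOpen hx
      exact ⟨n, fun y hy => iff_of_false (hn y hy) hx⟩
  choose n hn using hloc
  have hopen : ∀ x : CantorC, IsOpen {y : CantorC | ∀ i < n x, y i = x i} := by
    intro x
    have : {y : CantorC | ∀ i < n x, y i = x i} =
        ⋂ i ∈ Finset.range (n x), (fun y : CantorC => y i) ⁻¹' {x i} := by
      ext y
      simp
    rw [this]
    exact isOpen_biInter_finset fun i _ => (isOpen_discrete _).preimage (continuous_apply i)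
  obtain ⟨t, ht⟩ := isCompact_univ.elim_finite_subcover _ hopen
    fun x _ => mem_iUnion.2 ⟨x, fun _ _ => rfl⟩
  refine ⟨t.sup n, fun x y hxy => ?_⟩
  obtain ⟨z, hz, hxz⟩ := mem_iUnion₂.1 (ht (mem_univ x))
  rw [hn z x hxz, hn z y fun i hi => ?_]
  rw [← hxy i (hi.trans_le (Finset.le_sup hz)), hxz i hi]

theorem measure_inter_cylinders (μ : Measure CantorC) (p : Set CantorC) {A : List BWord}
    (hA : A.Pairwise LeftOf) :
    μ (p ∩ {x | ∃ a ∈ A, x ∈ cyl a}) = (A.map fun a => μ (p ∩ cyl a)).sum := by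
  induction A with
  | nil => simp
  | cons a A ih =>
    rw [List.pairwise_cons] at hA
    rw [List.map_cons, List.sum_cons, ← ih hA.2,
      ← measure_inter_add_sdiff _ (measurableSet_cyl a)]
    congr 2
    · ext x
      simp +contextual
    · ext x
      simp only [List.mem_cons, exists_eq_or_imp, Set.mem_sdiff, mem_inter_iff, mem_ofPred_eq]
      constructor
      · tauto
      · rintro ⟨hx, b, hb, hxb⟩
        exact ⟨⟨hx, .inr ⟨b, hb, hxb⟩⟩, fun hxa => (hA.1 b hb).notMem_cyl hxa hxb⟩

open Classical in
theorem measure_eq_countP_mul {μ : Measure CantorC}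
    (hμ : ∀ w : BWord, μ (cyl w) = (2 : ENNReal)⁻¹ ^ w.length) {p : Set CantorC} {n : ℕ}
    (hp : ∀ w ∈ levelWords n, cyl w ⊆ p ∨ cyl w ⊆ pᶜ) :
    μ p = (levelWords n).countP (fun w => cyl w ⊆ p) * (2 : ENNReal)⁻¹ ^ n := by
  have hA := isLeafList_levelWords n
  have h := measure_inter_cylinders μ p hA.1
  rw [show {x | ∃ a ∈ levelWords n, x ∈ cyl a} = univ from eq_univ_of_forall hA.2,
    inter_univ] at h
  rw [h]
  have hlen : ∀ w ∈ levelWords n, w.length = n := fun w => length_of_mem_levelWords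
  clear h hA
  generalize levelWords n = A at hp hlen
  induction A with
  | nil => simp
  | cons w A ih =>
    rw [List.map_cons, List.sum_cons, List.countP_cons,
      ih (fun v hv => hp v (.tail _ hv)) (fun v hv => hlen v (.tail _ hv))]
    by_cases hw : cyl w ⊆ p
    · rw [inter_eq_right.2 hw, hμ, hlen w (by simp)]
      simp [hw, add_mul, add_comm]
    · have hdisj : p ∩ cyl w = ∅ := by
        have := (hp w (by simp)).resolve_left hw
        rw [inter_comm]
        exact (disjoint_left.2 this).inter_eq
      simp [hw, hdisj]

theorem sum_map_parityWeight {α : Type*} (q : α → Bool) (l : List α) :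
    (l.map fun a => parityWeight (q a)).sum = 2 * (l.countP q : ZMod 3) - l.length := by
  induction l with
  | nil => simp
  | cons a l ih =>
    rw [List.map_cons, List.sum_cons, ih, List.countP_cons, List.length_cons]
    cases q a <;> simp [parityWeight] <;> ring

theorem natCast_eq_one_of_div_two_pow_eq {a k m n : ℕ} (hk : (3 : ℤ) ∣ (k : ℤ) - 2)
    (h : (a : ENNReal) * (2 : ENNReal)⁻¹ ^ (2 * n) = k / 2 ^ (2 * m + 1)) :
    (a : ZMod 3) = 1 := by
  have h1 : a * 2 ^ (2 * m + 1) = k * 2 ^ (2 * n) := by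
    rw [← ENNReal.inv_pow, ← div_eq_mul_inv,
      ENNReal.div_eq_div_iff (by simp) (by simp) (by simp) (by simp)] at h
    have h' : 2 ^ (2 * m + 1) * a = 2 ^ (2 * n) * k := by exact_mod_cast h
    linarith
  have h2 := congrArg (Nat.cast : ℕ → ZMod 3) h1
  have h3 : (k : ZMod 3) = 2 := by
    have := (ZMod.intCast_zmod_eq_zero_iff_dvd _ 3).2 hk
    push_cast at this
    exact sub_eq_zero.1 this
  have h4 : ((2 : ZMod 3) ^ 2) = 1 := by decide
  push_cast at h2
  rw [pow_succ, pow_mul, pow_mul, h4, h3, one_pow, one_pow] at h2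
  generalize (a : ZMod 3) = c at h2 ⊢
  revert c
  decide

/-- every clopen `p ⊆ C` with `μ(p) = k / 2^(2m+1)`, `0 < k ≤ 2^(2m+1)`,
`3 ∣ k − 2`, belongs to `Ω₂`, where `μ` is the uniform Bernoulli measure
(characterized by `μ(C_w) = 2^(−|w|)`). -/
theorem stmt11 (μ : Measure CantorC)
    (hμ : ∀ w : BWord, μ (cyl w) = (2 : ENNReal)⁻¹ ^ w.length)
    (p : Set CantorC) (hp : IsClopen p) (m k : ℕ)
    (hk0 : 0 < k) (hk1 : k ≤ 2 ^ (2 * m + 1)) (hk2 : (3 : ℤ) ∣ (k : ℤ) - 2)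
    (hμp : μ p = (k : ENNReal) / 2 ^ (2 * m + 1)) :
    p ∈ Omega2 := by
  classical
  obtain ⟨n, hn⟩ := hp.exists_nat_forall_eq_imp_mem_iff
  have hmem : ∀ w ∈ levelWords (2 * n), ∀ x ∈ cyl w, (x ∈ p ↔ cyl w ⊆ p) := by
    intro w hw x hx
    refine ⟨fun hxp y hy => ?_, fun h => h hx⟩
    have hlen := length_of_mem_levelWords hw
    refine (hn y x fun i hi => ?_).2 hxp
    rw [mem_cyl_iff.1 hx i (by omega), mem_cyl_iff.1 hy i (by omega)]
  have hsub : ∀ w ∈ levelWords (2 * n), cyl w ⊆ p ∨ cyl w ⊆ pᶜ := by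
    intro w hw
    by_cases h : cyl w ⊆ p
    · exact .inl h
    · exact .inr fun x hx hxp => h ((hmem w hw x hx).1 hxp)
  have hcount := natCast_eq_one_of_div_two_pow_eq hk2
    ((measure_eq_countP_mul hμ hsub).symm.trans hμp)
  have hL : IsParityMarking p ((levelWords (2 * n)).map fun w => (w, decide (cyl w ⊆ p))) := by
    refine ⟨?_, ?_⟩
    · rw [List.map_map]
      convert isLeafList_levelWords (2 * n)
      exact List.map_id _
    · simp only [List.mem_map]
      rintro _ ⟨w, hw, rfl⟩ x hx
      simpa [length_of_mem_levelWords hw] using hmem w hw x hx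
  obtain ⟨z, hz, hz'⟩ := parityGood_of_sum
    (((levelWords (2 * n)).map fun w => (w, decide (cyl w ⊆ p))).map Prod.snd) (by
      have h4 : ((2 : ZMod 3) ^ 2) = 1 := by decide
      have h := sum_map_parityWeight (fun w => decide (cyl w ⊆ p)) (levelWords (2 * n))
      rw [hcount, length_levelWords, Nat.cast_pow, Nat.cast_ofNat, pow_mul, h4, one_pow] at h
      simp only [List.map_map]
      exact h.trans (by decide))
  obtain ⟨L, hL, hLz⟩ := hL.exists_of_steps hz
  obtain ⟨M, hM, hMz⟩ := isParityMarking_root.exists_of_steps hz'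
  exact mem_Omega2_of_isParityMarking hL hM (hLz.trans hMz.symm)
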